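/- Let F be the free group on a set S, let w ∈ F, and let G = F/⟪w⟫ be a one-relator group. Then there exists an integer n ≥ 0 such that the quotient group D^n(G)/D^ω(G) is a free group; that is, D^n(G) is an extension of the maximal rationally perfect subgroup D^ω(G) of G by a free group. -/

import Mathlib

def ratDerived (G : Type*) [Group G] : ℕ → Subgroup G
  | 0 => ⊤
  | i + 1 =>
      Subgroup.closure
        {g | g ∈ ratDerived G i ∧
          ∃ k : ℕ, 1 ≤ k ∧ g ^ k ∈ ⁅ratDerived G i, ratDerived G i⁆}

instance ratDerived_normal (G : Type*) [Group G] (i : ℕ) : (ratDerived G i).Normal := by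
  induction i with
  | zero =>
    show (⊤ : Subgroup G).Normal
    infer_instance
  | succ i ih =>
    haveI := ih
    constructor
    intro x hx g
    have himg : (fun y => g * y * g⁻¹) ''
        {y | y ∈ ratDerived G i ∧ ∃ k : ℕ, 1 ≤ k ∧ y ^ k ∈ ⁅ratDerived G i, ratDerived G i⁆} ⊆
        {y | y ∈ ratDerived G i ∧ ∃ k : ℕ, 1 ≤ k ∧ y ^ k ∈ ⁅ratDerived G i, ratDerived G i⁆} := by
      rintro _ ⟨y, ⟨hy, k, hk, hyk⟩, rfl⟩
      refine ⟨ih.conj_mem y hy g, k, hk, ?_⟩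
      rw [conj_pow]
      exact (Subgroup.commutator_normal _ _).conj_mem _ hyk g
    have hmap : (ratDerived G (i + 1)).map (MulAut.conj g).toMonoidHom ≤ ratDerived G (i + 1) := by
      show (Subgroup.closure _).map _ ≤ Subgroup.closure _
      rw [MonoidHom.map_closure]
      refine (Subgroup.closure_le _).2 (fun y hy => Subgroup.subset_closure (himg ?_))
      simpa using hy
    exact hmap ⟨x, hx, rfl⟩

def ratDerivedOmega (G : Type*) [Group G] : Subgroup G := ⨅ i, ratDerived G i

instance ratDerivedOmega_normal (G : Type*) [Group G] : (ratDerivedOmega G).Normal := by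
  constructor
  intro x hx g
  simp only [ratDerivedOmega, Subgroup.mem_iInf] at hx ⊢
  exact fun i => (ratDerived_normal G i).conj_mem x (hx i) g

def QSolvable (G : Type*) [Group G] : Prop := ∃ n : ℕ, ratDerived G n = ⊥

def ResiduallyQSolvable (G : Type*) [Group G] : Prop := ratDerivedOmega G = ⊥

instance (G : Type*) [Group G] (n : ℕ) :
    ((ratDerivedOmega G).subgroupOf (ratDerived G n)).Normal :=
  (ratDerivedOmega_normal G).subgroupOf _

open scoped commutatorElement

section RationalDerivedSeries

variable {G : Type*} [Group G]

lemma exists_pow_mul_mem_commutator {H : Subgroup G} [H.Normal] {a b : G} (ha : a ∈ H)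
    (hb : b ∈ H) (ha' : ∃ k : ℕ, 1 ≤ k ∧ a ^ k ∈ ⁅H, H⁆) (hb' : ∃ k : ℕ, 1 ≤ k ∧ b ^ k ∈ ⁅H, H⁆) :
    ∃ k : ℕ, 1 ≤ k ∧ (a * b) ^ k ∈ ⁅H, H⁆ := by
  obtain ⟨k, hk, hak⟩ := ha'
  obtain ⟨l, hl, hbl⟩ := hb'
  refine ⟨k * l, Nat.mul_pos hk hl, ?_⟩
  rw [← QuotientGroup.eq_one_iff] at hak hbl ⊢
  have hc : Commute (a : G ⧸ ⁅H, H⁆) b := by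
    have := (QuotientGroup.eq_one_iff (N := ⁅H, H⁆) ⁅a, b⁆).2
      (Subgroup.commutator_mem_commutator ha hb)
    rw [← QuotientGroup.mk'_apply, map_commutatorElement, commutatorElement_eq_one_iff_commute]
      at this
    exact this
  rw [QuotientGroup.mk_pow, QuotientGroup.mk_mul, hc.mul_pow, pow_mul, ← QuotientGroup.mk_pow, hak,
    one_pow, one_mul, mul_comm k, pow_mul, ← QuotientGroup.mk_pow, hbl, one_pow]

theorem mem_ratDerived_succ {i : ℕ} {g : G} :
    g ∈ ratDerived G (i + 1) ↔ g ∈ ratDerived G i ∧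
      ∃ k : ℕ, 1 ≤ k ∧ g ^ k ∈ ⁅ratDerived G i, ratDerived G i⁆ := by
  refine ⟨fun h ↦ ?_, fun h ↦ Subgroup.subset_closure h⟩
  induction h using Subgroup.closure_induction with
  | mem x hx => exact hx
  | one => exact ⟨one_mem _, 1, le_rfl, by simp⟩
  | mul x y _ _ hx hy =>
    exact ⟨mul_mem hx.1 hy.1, exists_pow_mul_mem_commutator hx.1 hy.1 hx.2 hy.2⟩
  | inv x _ hx =>
    obtain ⟨h, k, hk, hxk⟩ := hx
    exact ⟨inv_mem h, k, hk, by rw [inv_pow]; exact inv_mem hxk⟩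

lemma ratDerived_succ_le (i : ℕ) : ratDerived G (i + 1) ≤ ratDerived G i :=
  fun _ h ↦ (mem_ratDerived_succ.1 h).1

lemma ratDerived_antitone : Antitone (ratDerived G) := antitone_nat_of_succ_le ratDerived_succ_le

lemma mem_ratDerived_succ_of_pow_mem {i k : ℕ} {g : G} (hg : g ∈ ratDerived G i) (hk : 1 ≤ k)
    (h : g ^ k ∈ ratDerived G (i + 1)) : g ∈ ratDerived G (i + 1) := by
  obtain ⟨-, l, hl, h⟩ := mem_ratDerived_succ.1 h
  exact mem_ratDerived_succ.2 ⟨hg, k * l, Nat.mul_pos hk hl, by rwa [pow_mul]⟩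

lemma map_ratDerived_le {H : Type*} [Group H] (f : G →* H) (i : ℕ) :
    (ratDerived G i).map f ≤ ratDerived H i := by
  induction i with
  | zero => exact le_top
  | succ i ih =>
    rintro _ ⟨g, hg, rfl⟩
    obtain ⟨h, k, hk, hgk⟩ := mem_ratDerived_succ.1 hg
    refine mem_ratDerived_succ.2 ⟨ih ⟨g, h, rfl⟩, k, hk, ?_⟩
    rw [← map_pow]
    exact (Subgroup.map_commutator _ _ f).le.trans (Subgroup.commutator_mono ih ih) ⟨_, hgk, rfl⟩

lemma ratDerivedOmega_eq_bot_of_injective {H : Type*} [Group H] (f : G →* H)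
    (hf : Function.Injective f) (h : ratDerivedOmega H = ⊥) : ratDerivedOmega G = ⊥ := by
  rw [eq_bot_iff] at h ⊢
  intro g hg
  have : f g ∈ ratDerivedOmega H :=
    Subgroup.mem_iInf.2 fun i ↦ map_ratDerived_le f i ⟨g, Subgroup.mem_iInf.1 hg i, rfl⟩
  exact hf ((h this).trans f.map_one.symm)

lemma ratDerived_add_le (n m : ℕ) :
    ratDerived G (n + m) ≤ (ratDerived (ratDerived G n) m).map (ratDerived G n).subtype := by
  induction m with
  | zero => exact fun g hg ↦ ⟨⟨g, hg⟩, Subgroup.mem_top _, rfl⟩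
  | succ m ih =>
    intro g hg
    obtain ⟨h, k, hk, hgk⟩ := mem_ratDerived_succ.1 hg
    obtain ⟨x, hx, rfl⟩ := ih h
    refine ⟨x, mem_ratDerived_succ.2 ⟨hx, k, hk, ?_⟩, rfl⟩
    have := Subgroup.commutator_mono ih ih hgk
    rw [← Subgroup.map_commutator, ← map_pow] at this
    obtain ⟨y, hy, hyx⟩ := this
    rwa [← (ratDerived G n).subtype_injective hyx]

lemma ratDerivedOmega_eq_bot_of_ratDerived {n : ℕ} (h : ratDerivedOmega (ratDerived G n) = ⊥) :
    ratDerivedOmega G = ⊥ := by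
  rw [eq_bot_iff] at h ⊢
  intro g hg
  rw [ratDerivedOmega, Subgroup.mem_iInf] at hg
  have : (⟨g, hg n⟩ : ratDerived G n) ∈ ratDerivedOmega (ratDerived G n) := by
    refine Subgroup.mem_iInf.2 fun m ↦ ?_
    obtain ⟨x, hx, hxg⟩ := ratDerived_add_le n m (hg (n + m))
    have : x = ⟨g, hg n⟩ := Subtype.ext hxg
    exact this ▸ hx
  exact congrArg Subtype.val (h this)

/-- The preimage in `G` of the rational derived series of `G ⧸ N`. -/
def relSeries (N : Subgroup G) [N.Normal] (i : ℕ) : Subgroup G :=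
  (ratDerived (G ⧸ N) i).comap (QuotientGroup.mk' N)

/-- The intersection of the series `relSeries N`. -/
def relOmega (N : Subgroup G) [N.Normal] : Subgroup G := ⨅ i, relSeries N i

variable (N : Subgroup G) [N.Normal]

instance relSeries_normal (i : ℕ) : (relSeries N i).Normal := by
  unfold relSeries; infer_instance

instance relOmega_normal : (relOmega N).Normal :=
  Subgroup.normal_iInf_normal fun i ↦ relSeries_normal N i

lemma relOmega_le (i : ℕ) : relOmega N ≤ relSeries N i := iInf_le _ i

@[simp] lemma relSeries_zero : relSeries N 0 = ⊤ := rfl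

lemma le_relSeries (i : ℕ) : N ≤ relSeries N i := fun g hg ↦ by
  simp [relSeries, (QuotientGroup.eq_one_iff g).2 hg]

lemma le_relOmega : N ≤ relOmega N := le_iInf (le_relSeries N)

lemma relSeries_antitone : Antitone (relSeries N) :=
  fun _ _ h ↦ Subgroup.comap_mono (ratDerived_antitone h)

lemma comap_commutator_ratDerived (i : ℕ) :
    ⁅ratDerived (G ⧸ N) i, ratDerived (G ⧸ N) i⁆.comap (QuotientGroup.mk' N) =
      ⁅relSeries N i, relSeries N i⁆ ⊔ N := by
  have : ratDerived (G ⧸ N) i = (relSeries N i).map (QuotientGroup.mk' N) :=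
    (Subgroup.map_comap_eq_self_of_surjective (QuotientGroup.mk'_surjective N) _).symm
  rw [this, ← Subgroup.map_commutator, Subgroup.comap_map_eq, QuotientGroup.ker_mk']

lemma mem_relSeries_succ {i : ℕ} {g : G} : g ∈ relSeries N (i + 1) ↔ g ∈ relSeries N i ∧
    ∃ k : ℕ, 1 ≤ k ∧ g ^ k ∈ ⁅relSeries N i, relSeries N i⁆ ⊔ N := by
  simp only [← comap_commutator_ratDerived]
  exact mem_ratDerived_succ

lemma commutator_le_relSeries_succ (i : ℕ) :
    ⁅relSeries N i, relSeries N i⁆ ≤ relSeries N (i + 1) := fun g hg ↦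
  (mem_relSeries_succ N).2 ⟨Subgroup.commutator_le_left _ _ hg, 1, le_rfl, by
    simpa using Subgroup.mem_sup_left hg⟩

lemma mem_relSeries_succ_of_pow_mem {i k : ℕ} {g : G} (hg : g ∈ relSeries N i) (hk : 1 ≤ k)
    (h : g ^ k ∈ relSeries N (i + 1)) : g ∈ relSeries N (i + 1) :=
  mem_ratDerived_succ_of_pow_mem hg hk h

variable {N}

lemma relSeries_succ_le {M : Subgroup G} [M.Normal] {i : ℕ}
    (h : relSeries N i ≤ relSeries M i) (hN : N ≤ relSeries M (i + 1)) :
    relSeries N (i + 1) ≤ relSeries M (i + 1) := by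
  intro g hg
  obtain ⟨hgi, k, hk, hgk⟩ := (mem_relSeries_succ N).1 hg
  refine mem_relSeries_succ_of_pow_mem M (h hgi) hk ?_
  exact sup_le ((Subgroup.commutator_mono h h).trans (commutator_le_relSeries_succ M i)) hN hgk

lemma comap_ratDerivedOmega :
    (ratDerivedOmega (G ⧸ N)).comap (QuotientGroup.mk' N) = relOmega N := by
  ext g
  simp [ratDerivedOmega, relOmega, relSeries, Subgroup.mem_iInf]

/-- Finitely many cosets are already separated at a finite stage of the series. -/
lemma exists_injOn_relSeries (X : Set (G ⧸ relOmega N)) (hX : X.Finite) :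
    ∃ j, ∀ i, j ≤ i → Set.InjOn (QuotientGroup.map (relOmega N) (relSeries N i) (MonoidHom.id G)
      (relOmega_le N i)) X := by
  have key : ∀ p : (G ⧸ relOmega N) × (G ⧸ relOmega N), ∃ j, ∀ i, j ≤ i →
      QuotientGroup.map (relOmega N) (relSeries N i) (MonoidHom.id G) (relOmega_le N i) p.1 =
        QuotientGroup.map (relOmega N) (relSeries N i) (MonoidHom.id G) (relOmega_le N i) p.2 →
      p.1 = p.2 := by
    rintro ⟨⟨a⟩, ⟨b⟩⟩
    by_cases h : a⁻¹ * b ∈ relOmega N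
    · exact ⟨0, fun _ _ _ ↦ QuotientGroup.eq.2 h⟩
    · rw [relOmega, Subgroup.mem_iInf, not_forall] at h
      obtain ⟨j, hj⟩ := h
      exact ⟨j, fun i hi h ↦ absurd (relSeries_antitone N hi (QuotientGroup.eq.1 h)) hj⟩
  choose J hJ using key
  obtain ⟨j, hj⟩ := ((hX.prod hX).image J).bddAbove
  exact ⟨j, fun i hi a ha b hb ↦ hJ (a, b) i ((hj ⟨(a, b), ⟨ha, hb⟩, rfl⟩).trans hi)⟩

/-- If `M` and `N` have the same series and `G ⧸ M` is residually rationally solvable, then the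
quotients of the rational derived series of `G ⧸ N` by its intersection come from `G ⧸ M`. -/
lemma isFreeGroup_quotient_of_relSeries_eq {M : Subgroup G} [M.Normal]
    (h : ∀ i, relSeries N i = relSeries M i) (hM : ratDerivedOmega (G ⧸ M) = ⊥) {n : ℕ}
    (hn : IsFreeGroup (ratDerived (G ⧸ M) n)) :
    IsFreeGroup (ratDerived (G ⧸ N) n ⧸ (ratDerivedOmega (G ⧸ N)).subgroupOf
      (ratDerived (G ⧸ N) n)) := by
  have hω : relOmega N = M := by
    have : relOmega N = relOmega M := iInf_congr h
    rw [this, ← comap_ratDerivedOmega, hM]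
    simp
  let θ : G ⧸ N →* G ⧸ M := QuotientGroup.map N M (MonoidHom.id G) (hω ▸ le_relOmega N)
  have hθ : ∀ x, x ∈ ratDerived (G ⧸ N) n ↔ θ x ∈ ratDerived (G ⧸ M) n := by
    rintro ⟨g⟩
    exact (SetLike.ext_iff.1 (h n)) g
  let ρ : ratDerived (G ⧸ N) n →* ratDerived (G ⧸ M) n :=
    (θ.comp (ratDerived (G ⧸ N) n).subtype).codRestrict _ fun x ↦ (hθ x).1 x.2
  have hρ : Function.Surjective ρ := by
    rintro ⟨⟨g⟩, hg⟩
    exact ⟨⟨(g : G ⧸ N), (hθ _).2 hg⟩, rfl⟩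
  have hker : ρ.ker = (ratDerivedOmega (G ⧸ N)).subgroupOf (ratDerived (G ⧸ N) n) := by
    ext ⟨⟨g⟩, hg⟩
    have h1 : g ∈ M ↔ (g : G ⧸ N) ∈ ratDerivedOmega (G ⧸ N) := by
      rw [← hω, ← comap_ratDerivedOmega]; rfl
    rw [Subgroup.mem_subgroupOf, MonoidHom.mem_ker]
    refine Iff.trans ?_ h1
    rw [← QuotientGroup.eq_one_iff]
    exact Subtype.ext_iff
  exact IsFreeGroup.ofMulEquiv
    ((QuotientGroup.quotientKerEquivOfSurjective ρ hρ).symm.trans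
      (QuotientGroup.quotientMulEquivOfEq hker))

end RationalDerivedSeries

section Holonomy

variable {S Q Q' X Y : Type*} [Group Q] [Group Q'] [Group X] [Group Y]

/-- The action of a group `Q` on functions on `Q` by right translation. -/
def rightShift (Q X : Type*) [Group Q] [Group X] : Q →* MulAut (Q → X) where
  toFun g :=
    { toFun := fun f q ↦ f (q * g)
      invFun := fun f q ↦ f (q * g⁻¹)
      left_inv := fun f ↦ by simp
      right_inv := fun f ↦ by simp
      map_mul' := fun _ _ ↦ rfl }
  map_one' := by ext; simp
  map_mul' _ _ := by ext; simp [mul_assoc]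

/-- The wreath product representation of a free group given by a labelling of the edges `(q, s)`
from `q` to `q * π s` of the Cayley graph of `π`. -/
def holHom (π : FreeGroup S →* Q) (f : Q × S → X) :
    FreeGroup S →* (Q → X) ⋊[rightShift Q X] Q :=
  FreeGroup.lift fun s ↦ ⟨fun q ↦ f (q, s), π (FreeGroup.of s)⟩

lemma holHom_right (π : FreeGroup S →* Q) (f : Q × S → X) (u : FreeGroup S) :
    (holHom π f u).right = π u := by
  have : SemidirectProduct.rightHom.comp (holHom π f) = π := by
    ext s; simp [holHom]
  exact DFunLike.congr_fun this u

/-- The product of the edge labels along the path spelled by `u` and starting at `q`. -/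
def hol (π : FreeGroup S →* Q) (f : Q × S → X) (u : FreeGroup S) (q : Q) : X :=
  (holHom π f u).left q

variable (π : FreeGroup S →* Q) (f : Q × S → X)

@[simp] lemma hol_one (q : Q) : hol π f 1 q = 1 := by simp [hol]

lemma hol_mul (u v : FreeGroup S) (q : Q) :
    hol π f (u * v) q = hol π f u q * hol π f v (q * π u) := by
  rw [hol, map_mul, SemidirectProduct.mul_left, holHom_right]; rfl

@[simp] lemma hol_of (s : S) (q : Q) : hol π f (FreeGroup.of s) q = f (q, s) := by
  simp [hol, holHom]

lemma hol_inv (u : FreeGroup S) (q : Q) :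
    hol π f u⁻¹ q = (hol π f u (q * (π u)⁻¹))⁻¹ := by
  have := hol_mul π f u⁻¹ u q
  rw [inv_mul_cancel, hol_one, map_inv] at this
  exact eq_inv_of_mul_eq_one_left this.symm

lemma map_hol (φ : X →* Y) (u : FreeGroup S) (q : Q) :
    φ (hol π f u q) = hol π (fun e ↦ φ (f e)) u q := by
  induction u using FreeGroup.induction_on generalizing q with
  | C1 => simp
  | of s => simp
  | inv_of s h => rw [hol_inv, hol_inv, map_inv, h]
  | mul u v hu hv => rw [hol_mul, hol_mul, map_mul, hu, hv]

lemma hol_comp (ψ : Q →* Q') (f : Q' × S → X) (u : FreeGroup S) (q : Q) :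
    hol (ψ.comp π) f u (ψ q) = hol π (fun e ↦ f (ψ e.1, e.2)) u q := by
  induction u using FreeGroup.induction_on generalizing q with
  | C1 => simp
  | of s => simp
  | inv_of s h =>
    rw [hol_inv, hol_inv, ← h]; simp
  | mul u v hu hv => rw [hol_mul, hol_mul, hu, ← hv]; simp

lemma hol_translate (g q : Q) (u : FreeGroup S) :
    hol π f u (g * q) = hol π (fun e ↦ f (g * e.1, e.2)) u q := by
  induction u using FreeGroup.induction_on generalizing q with
  | C1 => simp
  | of s => simp
  | inv_of s h =>
    rw [hol_inv, hol_inv, ← h, mul_assoc]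
  | mul u v hu hv => rw [hol_mul, hol_mul, hu, ← hv, mul_assoc]

/-- A labelling which is a coboundary-like twist of a representation of the free group. -/
lemma hol_section (θ : FreeGroup S →* X) (σ : Q → X) (u : FreeGroup S) (q : Q) :
    hol π (fun e ↦ σ e.1 * θ (FreeGroup.of e.2) * (σ (e.1 * π (FreeGroup.of e.2)))⁻¹) u q =
      σ q * θ u * (σ (q * π u))⁻¹ := by
  induction u using FreeGroup.induction_on generalizing q with
  | C1 => simp
  | of s => simp
  | inv_of s h =>
    rw [hol_inv, h]; simp [mul_assoc]
  | mul u v hu hv => rw [hol_mul, hu, hv]; simp [mul_assoc]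

/-- If the relator has trivial holonomy everywhere, then holonomy is trivial on its normal
closure. -/
lemma hol_eq_one_of_mem_normalClosure {c u : FreeGroup S} (hπ : π c = 1)
    (h : ∀ q, hol π f c q = 1) (hu : u ∈ Subgroup.normalClosure {c}) (q : Q) :
    hol π f u q = 1 := by
  have hc : holHom π f c = 1 := by
    ext q
    · exact h q
    · rw [holHom_right, hπ]; rfl
  have : Subgroup.normalClosure {c} ≤ (holHom π f).ker :=
    Subgroup.normalClosure_le_normal (by simpa using hc)
  rw [hol, (this hu : holHom π f u = 1)]; rfl

/-- The path in the Cayley graph of `π` spelled by a word, as a list of signed edges. -/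
def pathEdges : Q → List (S × Bool) → List ((Q × S) × Bool)
  | _, [] => []
  | q, (s, true) :: l => ((q, s), true) :: pathEdges (q * π (FreeGroup.of s)) l
  | q, (s, false) :: l =>
      ((q * (π (FreeGroup.of s))⁻¹, s), false) :: pathEdges (q * (π (FreeGroup.of s))⁻¹) l

/-- The label of a signed edge. -/
def signedLabel (f : Q × S → X) (e : (Q × S) × Bool) : X := if e.2 then f e.1 else (f e.1)⁻¹

lemma hol_mk (l : List (S × Bool)) (q : Q) :
    hol π f (FreeGroup.mk l) q = ((pathEdges π q l).map (signedLabel f)).prod := by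
  induction l generalizing q with
  | nil => simp [pathEdges, ← FreeGroup.one_eq_mk]
  | cons a l ih =>
    obtain ⟨s, b⟩ := a
    have : FreeGroup.mk ((s, b) :: l) = FreeGroup.mk [(s, b)] * FreeGroup.mk l := by simp
    rw [this, hol_mul, ih]
    cases b with
    | true =>
      have : FreeGroup.mk [(s, true)] = FreeGroup.of s := rfl
      simp [this, pathEdges, signedLabel]
    | false =>
      have : FreeGroup.mk [(s, false)] = (FreeGroup.of s)⁻¹ := rfl
      simp [this, pathEdges, signedLabel, hol_inv]

lemma pathEdges_translate (g q : Q) (l : List (S × Bool)) :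
    pathEdges π (g * q) l =
      (pathEdges π q l).map (Prod.map (Prod.map (g * ·) id) id) := by
  induction l generalizing q with
  | nil => rfl
  | cons a l ih =>
    obtain ⟨s, _ | _⟩ := a <;> simp [pathEdges, ← ih, mul_assoc]

lemma pathEdges_comp (ψ : Q →* Q') (q : Q) (l : List (S × Bool)) :
    pathEdges (ψ.comp π) (ψ q) l =
      (pathEdges π q l).map (Prod.map (Prod.map ψ id) id) := by
  induction l generalizing q with
  | nil => rfl
  | cons a l ih =>
    obtain ⟨s, _ | _⟩ := a <;> simp [pathEdges, ← ih]

lemma length_pathEdges (q : Q) (l : List (S × Bool)) : (pathEdges π q l).length = l.length := by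
  induction l generalizing q with
  | nil => rfl
  | cons a l ih => obtain ⟨s, _ | _⟩ := a <;> simp [pathEdges, ih]

/-- The Fox chain of `u` based at `q`: the sum of the edges traversed by the path spelled by `u`
from `q`. -/
noncomputable def fox (u : FreeGroup S) (q : Q) : (Q × S) →₀ ℤ :=
  (hol π (fun e ↦ Multiplicative.ofAdd (Finsupp.single e (1 : ℤ))) u q).toAdd

@[simp] lemma fox_one (q : Q) : fox π 1 q = 0 := by simp [fox]

lemma fox_mul (u v : FreeGroup S) (q : Q) :
    fox π (u * v) q = fox π u q + fox π v (q * π u) := by simp [fox, hol_mul]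

lemma fox_inv (u : FreeGroup S) (q : Q) : fox π u⁻¹ q = - fox π u (q * (π u)⁻¹) := by
  simp [fox, hol_inv]

lemma fox_pow {u : FreeGroup S} (hu : π u = 1) (k : ℕ) (q : Q) :
    fox π (u ^ k) q = k • fox π u q := by
  induction k with
  | zero => simp
  | succ k ih => rw [pow_succ, fox_mul, ih, map_pow, hu, one_pow, mul_one, succ_nsmul]

lemma fox_zpow {u : FreeGroup S} (hu : π u = 1) (k : ℤ) (q : Q) :
    fox π (u ^ k) q = k • fox π u q := by
  cases k with
  | ofNat k => simpa using fox_pow π hu k q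
  | negSucc k =>
    rw [zpow_negSucc, fox_inv, map_pow, hu, one_pow, inv_one, mul_one, fox_pow π hu, negSucc_zsmul]

lemma fox_of (s : S) (q : Q) : fox π (FreeGroup.of s) q = Finsupp.single (q, s) 1 := by
  simp [fox]

lemma fox_comp (ψ : Q →* Q') (u : FreeGroup S) (q : Q) :
    fox (ψ.comp π) u (ψ q) = (fox π u q).mapDomain (Prod.map ψ id) := by
  rw [fox, hol_comp]
  have := map_hol π (fun e ↦ Multiplicative.ofAdd (Finsupp.single e (1 : ℤ)))
    (AddMonoidHom.toMultiplicative (Finsupp.mapDomain.addMonoidHom (Prod.map ψ (id : S → S)))) u q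
  simp only [AddMonoidHom.toMultiplicative_apply_apply, toAdd_ofAdd,
    Finsupp.mapDomain.addMonoidHom_apply, Finsupp.mapDomain_single] at this
  exact (congrArg Multiplicative.toAdd this).symm

lemma fox_translate (g q : Q) (u : FreeGroup S) :
    fox π u (g * q) = (fox π u q).mapDomain (Prod.map (g * ·) id) := by
  rw [fox, hol_translate]
  have := map_hol π (fun e ↦ Multiplicative.ofAdd (Finsupp.single e (1 : ℤ)))
    (AddMonoidHom.toMultiplicative (Finsupp.mapDomain.addMonoidHom
      (Prod.map (g * ·) (id : S → S)))) u q
  simp only [AddMonoidHom.toMultiplicative_apply_apply, toAdd_ofAdd,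
    Finsupp.mapDomain.addMonoidHom_apply, Finsupp.mapDomain_single] at this
  exact (congrArg Multiplicative.toAdd this).symm

lemma fox_translate_apply (g q : Q) (u : FreeGroup S) (x : Q) (s : S) :
    fox π u (g * q) (g * x, s) = fox π u q (x, s) := by
  rw [fox_translate]
  exact Finsupp.mapDomain_apply (f := Prod.map (g * ·) id)
    ((mul_right_injective g).prodMap Function.injective_id) _ (x, s)

/-- Holonomy in a commutative group only depends on the Fox chain. -/
lemma hol_eq_of_fox_eq_zero {A : Type*} [CommGroup A] (f : Q × S → A) {u : FreeGroup S} {q : Q}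
    (h : fox π u q = 0) : hol π f u q = 1 := by
  let φ : ((Q × S) →₀ ℤ) →+ Additive A :=
    Finsupp.liftAddHom fun e ↦ (zmultiplesHom (Additive A)) (Additive.ofMul (f e))
  have := map_hol π (fun e ↦ Multiplicative.ofAdd (Finsupp.single e (1 : ℤ)))
    (AddMonoidHom.toMultiplicativeLeft φ) u q
  have h1 : ∀ e, (AddMonoidHom.toMultiplicativeLeft φ)
      (Multiplicative.ofAdd (Finsupp.single e (1 : ℤ))) = f e := by
    intro e
    simp [φ]
  simp only [h1] at this
  rw [← this]
  have h2 : hol π (fun e ↦ Multiplicative.ofAdd (Finsupp.single e (1 : ℤ))) u q = 1 := h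
  rw [h2, map_one]

/-- The boundary map on chains of the Cayley graph of `π`. -/
noncomputable def edgeBoundary : ((Q × S) →₀ ℤ) →+ (Q →₀ ℤ) :=
  Finsupp.liftAddHom fun e ↦
    Finsupp.singleAddHom (e.1 * π (FreeGroup.of e.2)) - Finsupp.singleAddHom e.1

lemma edgeBoundary_fox (u : FreeGroup S) (q : Q) :
    edgeBoundary π (fox π u q) = Finsupp.single (q * π u) 1 - Finsupp.single q 1 := by
  induction u using FreeGroup.induction_on generalizing q with
  | C1 => simp
  | of s => simp [fox_of, edgeBoundary]
  | inv_of s h => rw [fox_inv, map_neg, h]; simp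
  | mul u v hu hv => rw [fox_mul, map_add, hu, hv]; simp [mul_assoc]

lemma fox_mem_closure {w : FreeGroup S} (hw : π w = 1) {u : FreeGroup S}
    (hu : u ∈ ⁅π.ker, π.ker⁆ ⊔ Subgroup.normalClosure {w}) (q : Q) :
    fox π u q ∈ AddSubgroup.closure (Set.range (fox π w)) := by
  let H : Subgroup (FreeGroup S) :=
    { carrier := {u | π u = 1 ∧ ∀ q, fox π u q ∈ AddSubgroup.closure (Set.range (fox π w))}
      one_mem' := by simp
      mul_mem' := fun {a b} ha hb ↦ ⟨by rw [map_mul, ha.1, hb.1, one_mul], fun q ↦ by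
        rw [fox_mul]; exact add_mem (ha.2 _) (hb.2 _)⟩
      inv_mem' := fun {a} ha ↦ ⟨by rw [map_inv, ha.1, inv_one], fun q ↦ by
        rw [fox_inv]; exact neg_mem (ha.2 _)⟩ }
  have hH : H.Normal := ⟨fun a ha g ↦ ⟨by simp [ha.1], fun q ↦ by
    have : fox π (g * a * g⁻¹) q = fox π a (q * π g) := by
      simp [fox_mul, fox_inv, ha.1]
    rw [this]
    exact ha.2 _⟩⟩
  have h1 : ⁅π.ker, π.ker⁆ ≤ H := Subgroup.commutator_le.2 fun a ha b hb ↦ by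
    rw [MonoidHom.mem_ker] at ha hb
    refine ⟨by simp [commutatorElement_def, ha, hb], fun q ↦ ?_⟩
    have : fox π ⁅a, b⁆ q = 0 := by simp [commutatorElement_def, fox_mul, fox_inv, ha, hb]
    rw [this]
    exact zero_mem _
  have h2 : Subgroup.normalClosure {w} ≤ H := Subgroup.normalClosure_le_normal
    (Set.singleton_subset_iff.2 ⟨hw, fun q ↦ AddSubgroup.subset_closure ⟨q, rfl⟩⟩)
  exact (sup_le h1 h2 hu).2 q

lemma fox_eq_zero_of_mem_commutator {u : FreeGroup S} (hu : u ∈ ⁅π.ker, π.ker⁆) (q : Q) :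
    fox π u q = 0 := by
  have := fox_mem_closure π (map_one π) (Subgroup.mem_sup_left hu) q
  have h0 : Set.range (fox π 1) = {0} := by
    ext x; simp [eq_comm]
  rwa [h0, AddSubgroup.closure_singleton_zero, AddSubgroup.mem_bot] at this

/-- The injectivity of the Magnus embedding of the abelianized kernel. -/
lemma mem_commutator_of_fox_eq_zero (hπ : Function.Surjective π) {u : FreeGroup S} (hu : π u = 1)
    {q : Q} (h : fox π u q = 0) : u ∈ ⁅π.ker, π.ker⁆ := by
  obtain ⟨σ, hσ⟩ := hπ.hasRightInverse
  let f : Q × S → π.ker := fun e ↦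
    ⟨σ e.1 * FreeGroup.of e.2 * (σ (e.1 * π (FreeGroup.of e.2)))⁻¹, by simp [hσ _]⟩
  have h1 := hol_eq_of_fox_eq_zero π (fun e ↦ Abelianization.of (f e)) h
  rw [← map_hol] at h1
  have h2 : hol π f u q ∈ _root_.commutator π.ker := (QuotientGroup.eq_one_iff _).1 h1
  have h3 : ((hol π f u q : π.ker) : FreeGroup S) = σ q * u * (σ q)⁻¹ := by
    rw [← Subgroup.subtype_apply, map_hol]
    refine (hol_section π (MonoidHom.id _) σ u q).trans ?_
    simp [hu]
  have h4 : σ q * u * (σ q)⁻¹ ∈ ⁅π.ker, π.ker⁆ := by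
    rw [← h3, ← Subgroup.map_subtype_commutator]
    exact ⟨_, h2, rfl⟩
  simpa [mul_assoc] using (Subgroup.commutator_normal π.ker π.ker).conj_mem _ h4 (σ q)⁻¹

end Holonomy

section Cycles

variable {S Q : Type*} [Group Q] (π : FreeGroup S →* Q)

/-- The edge traversed when reading the letter `a` at the vertex `q`. -/
def letterEdge (q : Q) (a : S × Bool) : Q × S :=
  (if a.2 then q else q * (π (FreeGroup.of a.1))⁻¹, a.1)

/-- The vertex reached when reading the letter `a` at the vertex `q`. -/
def letterTarget (q : Q) (a : S × Bool) : Q :=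
  if a.2 then q * π (FreeGroup.of a.1) else q * (π (FreeGroup.of a.1))⁻¹

lemma pathEdges_cons (q : Q) (a : S × Bool) (l : List (S × Bool)) :
    pathEdges π q (a :: l) = (letterEdge π q a, a.2) :: pathEdges π (letterTarget π q a) l := by
  obtain ⟨s, _ | _⟩ := a <;> rfl

lemma mul_map_mk_cons (q : Q) (a : S × Bool) (l : List (S × Bool)) :
    q * π (FreeGroup.mk (a :: l)) = letterTarget π q a * π (FreeGroup.mk l) := by
  have : FreeGroup.mk (a :: l) = FreeGroup.mk [a] * FreeGroup.mk l := by simp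
  rw [this, map_mul, ← mul_assoc]
  obtain ⟨s, _ | _⟩ := a
  · have : FreeGroup.mk [(s, false)] = (FreeGroup.of s)⁻¹ := rfl
    simp [this, letterTarget]
  · have : FreeGroup.mk [(s, true)] = FreeGroup.of s := rfl
    simp [this, letterTarget]

/-- The path spelled by the letters chosen along an orbit of a map following these letters. -/
lemma pathEdges_iterate {W : Type*} (v : W → Q) (a : W → S × Bool) (nxt : W → W)
    (h : ∀ z, v (nxt z) = letterTarget π (v z) (a z)) (n : ℕ) (y : W) :
    pathEdges π (v y) ((List.iterate nxt y n).map a) =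
        (List.iterate nxt y n).map (fun z ↦ (letterEdge π (v z) (a z), (a z).2)) ∧
      v y * π (FreeGroup.mk ((List.iterate nxt y n).map a)) = v (nxt^[n] y) := by
  induction n generalizing y with
  | zero => simp [pathEdges, ← FreeGroup.one_eq_mk]
  | succ n ih =>
    simp only [List.iterate, List.map_cons, pathEdges_cons, mul_map_mk_cons, ← h,
      Function.iterate_succ_apply]
    exact ⟨by rw [(ih _).1], (ih _).2⟩

lemma edgeBoundary_apply [DecidableEq Q] (f : (Q × S) →₀ ℤ) (q : Q) :
    edgeBoundary π f q = ∑ e ∈ f.support, f e *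
      ((if e.1 * π (FreeGroup.of e.2) = q then 1 else 0) - (if e.1 = q then 1 else 0)) := by
  rw [edgeBoundary, Finsupp.liftAddHom_apply, Finsupp.sum, Finsupp.finsetSum_apply]
  refine Finset.sum_congr rfl fun e _ ↦ ?_
  simp [Finsupp.single_apply, mul_sub]

/-- A step along an edge in the direction in which the chain `f` flows. -/
def IsFlowStep (f : (Q × S) →₀ ℤ) (q : Q) (a : S × Bool) : Prop :=
  if a.2 then 0 < f (letterEdge π q a) else f (letterEdge π q a) < 0

variable {π}

lemma isFlowStep_of_pos {f : (Q × S) →₀ ℤ} {e : Q × S} (h : 0 < f e) :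
    IsFlowStep π f e.1 (e.2, true) := by simpa [IsFlowStep, letterEdge] using h

lemma isFlowStep_of_neg {f : (Q × S) →₀ ℤ} {e : Q × S} (h : f e < 0) :
    IsFlowStep π f (e.1 * π (FreeGroup.of e.2)) (e.2, false) := by
  simpa [IsFlowStep, letterEdge] using h

lemma exists_isFlowStep_letterTarget {f : (Q × S) →₀ ℤ} (hf : edgeBoundary π f = 0) {q : Q}
    {a : S × Bool} (ha : IsFlowStep π f q a) : ∃ b, IsFlowStep π f (letterTarget π q a) b := by
  classical
  by_contra! hV
  set q' := letterTarget π q a with hq'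
  have hpos : ∀ e, 0 < f e → e.1 ≠ q' := fun e he h ↦ hV _ (h ▸ isFlowStep_of_pos he)
  have hneg : ∀ e, f e < 0 → e.1 * π (FreeGroup.of e.2) ≠ q' := fun e he h ↦
    hV _ (h ▸ isFlowStep_of_neg he)
  have hsum := edgeBoundary_apply π f q'
  rw [hf, Finsupp.zero_apply, eq_comm, Finset.sum_eq_zero_iff_of_nonneg] at hsum
  · obtain ⟨s, _ | _⟩ := a
    · simp only [IsFlowStep, letterEdge, letterTarget, Bool.false_eq_true, if_false] at ha hq'
      have := hsum (q * (π (FreeGroup.of s))⁻¹, s) (by simp [ha.ne])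
      rw [if_neg (hneg _ ha), if_pos hq'.symm] at this
      lia
    · simp only [IsFlowStep, letterEdge, letterTarget, if_true] at ha hq'
      have := hsum (q, s) (by simp [ha.ne'])
      rw [if_neg (hpos _ ha), if_pos hq'.symm] at this
      lia
  · intro e _
    rcases lt_trichotomy (f e) 0 with h | h | h
    · rw [if_neg (hneg e h)]
      split_ifs <;> lia
    · simp [h]
    · rw [if_neg (hpos e h)]
      split_ifs <;> lia

/-- A nonzero cycle in the Cayley graph supports a simple closed path. -/
theorem exists_simple_closed_path {f : (Q × S) →₀ ℤ} (hf : edgeBoundary π f = 0) (hf0 : f ≠ 0) :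
    ∃ (x : Q) (l : List (S × Bool)), l ≠ [] ∧ π (FreeGroup.mk l) = 1 ∧
      ((pathEdges π x l).map Prod.fst).Nodup ∧ ∀ e ∈ (pathEdges π x l).map Prod.fst, f e ≠ 0 := by
  classical
  let W := {q : Q // ∃ a, IsFlowStep π f q a}
  have hW : Finite W := by
    refine Set.Finite.subset ((f.support.image Prod.fst) ∪
      f.support.image (fun e ↦ e.1 * π (FreeGroup.of e.2)) : Finset Q).finite_toSet ?_
    rintro q ⟨⟨s, _ | _⟩, h⟩ <;> simp only [IsFlowStep, letterEdge] at h
    · simp only [Finset.coe_union, Set.mem_union, Finset.mem_coe, Finset.mem_image]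
      exact Or.inr ⟨_, Finsupp.mem_support_iff.2 (by simpa using h.ne), by simp⟩
    · simp only [Finset.coe_union, Set.mem_union, Finset.mem_coe, Finset.mem_image]
      exact Or.inl ⟨_, Finsupp.mem_support_iff.2 (by simpa using h.ne'), by simp⟩
  obtain ⟨w⟩ : Nonempty W := by
    obtain ⟨e, he⟩ := DFunLike.ne_iff.1 hf0
    rcases lt_or_gt_of_ne he with h | h
    · exact ⟨⟨_, _, isFlowStep_of_neg h⟩⟩
    · exact ⟨⟨_, _, isFlowStep_of_pos h⟩⟩
  choose a ha using fun z : W ↦ z.2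
  let nxt : W → W := fun z ↦ ⟨letterTarget π z (a z), exists_isFlowStep_letterTarget hf (ha z)⟩
  obtain ⟨y, hy⟩ : ∃ y, y ∈ Function.periodicPts nxt := by
    obtain ⟨m, n, hmn, h⟩ := Finite.exists_ne_map_eq_of_infinite (fun n ↦ nxt^[n] w)
    wlog hlt : m < n generalizing m n
    · exact this n m hmn.symm h.symm (lt_of_le_of_ne (not_lt.1 hlt) hmn.symm)
    refine ⟨nxt^[m] w, n - m, by lia, ?_⟩
    change nxt^[n - m] (nxt^[m] w) = _
    rw [← Function.iterate_add_apply, Nat.sub_add_cancel hlt.le]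
    exact h.symm
  let p := Function.minimalPeriod nxt y
  have hp : 0 < p := Function.minimalPeriod_pos_of_mem_periodicPts hy
  obtain ⟨h1, h2⟩ := pathEdges_iterate π (Subtype.val : W → Q) a nxt (fun _ ↦ rfl) p y
  have hmap : (pathEdges π y ((List.iterate nxt y p).map a)).map Prod.fst =
      (List.iterate nxt y p).map fun z : W ↦ letterEdge π (z : Q) (a z) := by
    rw [h1, List.map_map]; rfl
  refine ⟨y, (List.iterate nxt y p).map a, ?_, ?_, ?_, ?_⟩
  · intro h
    have := congrArg List.length h
    simp only [List.length_map, List.length_iterate, List.length_nil] at this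
    lia
  · rw [Function.iterate_minimalPeriod] at h2
    simpa using h2
  · rw [hmap]
    refine List.Nodup.map ?_ ?_
    · intro z z' h
      have hz := ha z
      have hz' := ha z'
      simp only [IsFlowStep, ← h] at hz hz'
      have hb : (a z).2 = (a z').2 := by
        split_ifs at hz hz' with h1 h2 <;> simp_all <;> lia
      simp only [letterEdge, Prod.mk.injEq] at h
      rw [← h.2, ← hb] at h
      refine Subtype.ext ?_
      split_ifs at h
      · exact h.1
      · exact mul_right_cancel h.1
    · rw [← List.range_map_iterate]
      refine List.Nodup.map_on ?_ List.nodup_range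
      intro i hi j hj h
      exact Function.iterate_injOn_Iio_minimalPeriod (List.mem_range.1 hi) (List.mem_range.1 hj) h
  · rw [hmap]
    intro e he
    obtain ⟨z, -, rfl⟩ := List.mem_map.1 he
    have := ha z
    rw [IsFlowStep] at this
    split_ifs at this
    · exact this.ne'
    · exact this.ne

/-- The coefficient of an edge in the Fox chain of a path. -/
lemma fox_mk_apply (π : FreeGroup S →* Q) [DecidableEq (Q × S)] (x : Q) (l : List (S × Bool))
    (e : Q × S) : fox π (FreeGroup.mk l) x e =
      ((pathEdges π x l).map fun d ↦ if d.1 = e then (if d.2 then 1 else -1) else 0).sum := by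
  let φ : Multiplicative ((Q × S) →₀ ℤ) →* Multiplicative ℤ :=
    AddMonoidHom.toMultiplicative (Finsupp.applyAddHom e)
  have : fox π (FreeGroup.mk l) x e = (φ (hol π (fun e ↦ Multiplicative.ofAdd
    (Finsupp.single e (1 : ℤ))) (FreeGroup.mk l) x)).toAdd := rfl
  rw [this, hol_mk, map_list_prod, toAdd_list_sum, List.map_map, List.map_map]
  congr 1
  refine List.map_congr_left fun d _ ↦ ?_
  obtain ⟨d, _ | _⟩ := d <;> by_cases h : d = e <;> simp [φ, signedLabel, h]

lemma fox_mk_eq_zero {x : Q} {l : List (S × Bool)} {e : Q × S}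
    (h : e ∉ (pathEdges π x l).map Prod.fst) : fox π (FreeGroup.mk l) x e = 0 := by
  classical
  rw [fox_mk_apply]
  refine List.sum_eq_zero fun n hn ↦ ?_
  obtain ⟨d, hd, rfl⟩ := List.mem_map.1 hn
  exact if_neg fun hde ↦ h (List.mem_map.2 ⟨d, hd, hde⟩)

lemma fox_mk_ne_zero {x : Q} {l : List (S × Bool)} (hl : l ≠ [])
    (h : ((pathEdges π x l).map Prod.fst).Nodup) : fox π (FreeGroup.mk l) x ≠ 0 := by
  classical
  obtain ⟨a, l, rfl⟩ := List.exists_cons_of_ne_nil hl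
  intro h0
  have := DFunLike.congr_fun h0 (letterEdge π x a)
  rw [pathEdges_cons, List.map_cons, List.nodup_cons] at h
  rw [fox_mk_apply, pathEdges_cons, List.map_cons, List.sum_cons, List.sum_eq_zero] at this
  · obtain ⟨s, _ | _⟩ := a <;> simp at this
  · intro n hn
    obtain ⟨d, hd, rfl⟩ := List.mem_map.1 hn
    exact if_neg fun hde ↦ h.1 (List.mem_map.2 ⟨d, hd, hde⟩)

end Cycles

section Peeling

/-- A group is peelable if for every nonempty finite set `B` one can choose in every translate
`g • B` an element `g * β g` such that whenever it lies in another translate `g' • B`, the latter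
is strictly larger in some well-founded relation for which `1` is minimal. -/
def Peelable (Q : Type*) [Group Q] : Prop :=
  ∀ B : Finset Q, B.Nonempty → ∃ (β : Q → Q) (R : Q → Q → Prop), (∀ g, β g ∈ B) ∧ WellFounded R ∧
    (∀ g, ¬ R g 1) ∧ ∀ g g' b, b ∈ B → g ≠ g' → g * b = g' * β g' → R g' g

lemma Peelable.of_subsingleton (Q : Type*) [Group Q] [Subsingleton Q] : Peelable Q :=
  fun _ ⟨b, hb⟩ ↦ ⟨fun _ ↦ b, fun _ _ ↦ False, fun _ ↦ hb, ⟨fun _ ↦ ⟨_, fun _ h ↦ h.elim⟩⟩,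
    fun _ ↦ id, fun g g' _ _ h ↦ (h (Subsingleton.elim g g')).elim⟩

lemma exists_rat_separating {Q : Type*} [Group Q] (A : Subgroup Q)
    (hcomm : ∀ a ∈ A, ∀ b ∈ A, a * b = b * a) (htf : ∀ a ∈ A, ∀ k : ℕ, 1 ≤ k → a ^ k = 1 → a = 1)
    (X : Set Q) (hX : X.Finite) :
    ∃ φ : Q → ℚ, (∀ a ∈ A, ∀ b ∈ A, φ (a * b) = φ a + φ b) ∧ ∀ x ∈ X, x ∈ A → x ≠ 1 → φ x ≠ 0 := by
  classical
  let _ : CommGroup A :=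
    { (inferInstance : Group A) with mul_comm := fun a b ↦ Subtype.ext (hcomm a a.2 b b.2) }
  have : IsMulTorsionFree A := ⟨fun n hn a b hab ↦ by
    have : (a / b) ^ n = 1 := by rw [div_pow]; exact div_eq_one.2 hab
    exact div_eq_one.1 (Subtype.ext (htf _ (a / b).2 n (Nat.pos_of_ne_zero hn)
      (by simpa using congrArg Subtype.val this)))⟩
  let I := {x : X // (x : Q) ∈ A ∧ (x : Q) ≠ 1}
  have : Finite X := hX
  obtain ⟨f, hf⟩ := Module.exists_dual_forall_apply_ne_zero (K := ℚ)
    (fun i : I ↦ DivisibleHull.coeAddMonoidHom (Additive A)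
      (Additive.ofMul (⟨(i : X), i.2.1⟩ : A))) (fun i h ↦ i.2.2 (by
        have h := DivisibleHull.coe_injective
          (h.trans (map_zero (DivisibleHull.coeAddMonoidHom _)).symm)
        exact congrArg Subtype.val (Additive.ofMul.injective h)))
  refine ⟨fun q ↦ if h : q ∈ A then f (DivisibleHull.coeAddMonoidHom (Additive A)
      (Additive.ofMul (⟨q, h⟩ : A))) else 0, fun a ha b hb ↦ ?_, fun x hx hA h1 ↦ ?_⟩
  · beta_reduce
    rw [dif_pos ha, dif_pos hb, dif_pos (mul_mem ha hb), ← map_add, ← map_add]; rfl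
  · beta_reduce
    rw [dif_pos hA]
    exact hf ⟨⟨x, hx⟩, hA, h1⟩

lemma exists_pos_lower_bound (T : Finset ℚ) : ∃ δ : ℚ, 0 < δ ∧ ∀ x ∈ T, 0 < x → δ ≤ x := by
  classical
  by_cases h : (T.filter (0 < ·)).Nonempty
  · obtain ⟨δ, hδ, h⟩ := Finset.exists_min_image _ id h
    exact ⟨δ, (Finset.mem_filter.1 hδ).2, fun x hx h0 ↦ h x (Finset.mem_filter.2 ⟨hx, h0⟩)⟩
  · exact ⟨1, one_pos, fun x hx h0 ↦ (h ⟨x, Finset.mem_filter.2 ⟨hx, h0⟩⟩).elim⟩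

/-- Peelability passes to extensions with torsion-free abelian kernel. -/
theorem Peelable.of_ker {Q Q' : Type*} [Group Q] [Group Q'] (π : Q →* Q')
    (hπ : Function.Surjective π) (hcomm : ∀ a ∈ π.ker, ∀ b ∈ π.ker, a * b = b * a)
    (htf : ∀ a ∈ π.ker, ∀ k : ℕ, 1 ≤ k → a ^ k = 1 → a = 1) (h : Peelable Q') : Peelable Q := by
  classical
  intro B hB
  obtain ⟨β', R', hβ', hR', hR'1, hpeel⟩ := h (B.image π) (hB.image π)
  obtain ⟨φ, hφ, hsep⟩ := exists_rat_separating π.ker hcomm htf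
    ((B ×ˢ B).image fun p ↦ p.1⁻¹ * p.2 : Finset Q) (Finset.finite_toSet _)
  obtain ⟨σ, hσ⟩ := hπ.hasRightInverse
  let lev : Q → ℚ := fun q ↦ φ ((σ (π q))⁻¹ * q)
  have hlev : ∀ p p', π p = π p' → lev p' - lev p = φ (p⁻¹ * p') := by
    intro p p' hp
    have h1 : (σ (π p'))⁻¹ * p' = ((σ (π p))⁻¹ * p) * (p⁻¹ * p') := by
      rw [hp]; group
    simp only [lev]
    rw [h1, hφ _ (by simp [hσ _]) _ (by simp [hp])]
    ring
  have htrans : ∀ g b b', π b = π b' → lev (g * b') - lev (g * b) = lev b' - lev b := by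
    intro g b b' hb
    rw [hlev _ _ hb, hlev _ _ (by simp [hb])]
    congr 1; group
  have hinj : ∀ b ∈ B, ∀ b' ∈ B, π b = π b' → lev b = lev b' → b = b' := by
    intro b hb b' hb' hπb hl
    by_contra hne
    refine hsep (b⁻¹ * b') ?_ (by simp [hπb]) (by rwa [ne_eq, inv_mul_eq_one]) ?_
    · exact Finset.mem_coe.2 (Finset.mem_image.2 ⟨(b, b'), by simp [hb, hb'], rfl⟩)
    · rw [← hlev _ _ hπb, hl, sub_self]
  obtain ⟨δ, hδ0, hδ⟩ := exists_pos_lower_bound ((B ×ˢ B).image fun p ↦ lev p.2 - lev p.1)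
  replace hδ : ∀ b ∈ B, ∀ b' ∈ B, lev b < lev b' → δ ≤ lev b' - lev b := fun b hb b' hb' hlt ↦
    hδ _ (Finset.mem_image.2 ⟨(b, b'), by simp [hb, hb'], rfl⟩) (sub_pos.2 hlt)
  have hfib : ∀ g, (B.filter fun b ↦ π b = β' g).Nonempty := by
    intro g
    obtain ⟨b, hb, hbg⟩ := Finset.mem_image.1 (hβ' g)
    exact ⟨b, Finset.mem_filter.2 ⟨hb, hbg⟩⟩
  choose lo hlo hlo' using fun g ↦ Finset.exists_min_image _ lev (hfib g)
  choose hi hhi hhi' using fun g ↦ Finset.exists_max_image _ lev (hfib g)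
  simp only [Finset.mem_filter] at hlo hlo' hhi hhi'
  let t : Q → ℚ := fun g ↦ lev (g * lo (π g)) - lev (1 * lo (π 1))
  let N : Q → ℕ := fun g ↦ ⌊|t g| / δ⌋₊
  have hN : ∀ g g', |t g'| + δ ≤ |t g| → N g' < N g := by
    intro g g' h
    have h2 : |t g'| / δ + 1 ≤ |t g| / δ := by
      rw [div_add_one hδ0.ne']
      gcongr
    exact Nat.lt_of_succ_le ((Nat.floor_add_one (by positivity)).symm.le.trans
      (Nat.floor_mono h2))
  refine ⟨fun g ↦ if 0 ≤ t g then hi (π g) else lo (π g),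
    InvImage (Prod.Lex R' (· < ·)) fun g ↦ (π g, N g), ?_, ?_, ?_, ?_⟩
  · intro g
    dsimp only
    split_ifs
    exacts [(hhi _).1, (hlo _).1]
  · exact InvImage.wf _ (WellFounded.prod_lex hR' wellFounded_lt)
  · intro g h
    have hN1 : N 1 = 0 := by simp [N, t]
    rcases Prod.lex_def.1 h with h | ⟨-, h⟩
    · exact hR'1 _ (by simpa using h)
    · simp [hN1] at h
  · intro g g' b hb hne heq
    beta_reduce at heq
    refine Prod.lex_def.2 ?_
    have hmem : ∀ x, π (if 0 ≤ t x then hi (π x) else lo (π x)) = β' (π x) := by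
      intro x
      split_ifs
      exacts [(hhi _).2, (hlo _).2]
    have hπeq : π g * π b = π g' * β' (π g') := by
      rw [← map_mul, heq, map_mul, hmem]
    by_cases hgg : π g = π g'
    · refine Or.inr ⟨hgg.symm, hN _ _ ?_⟩
      have hπb : π b = β' (π g') := by rw [hgg] at hπeq; exact mul_left_cancel hπeq
      have hblo : lev (g * b) - lev (g * lo (π g')) = lev b - lev (lo (π g')) :=
        htrans _ _ _ ((hlo _).2.trans hπb.symm)
      have htg : t g = lev (g * lo (π g')) - lev (1 * lo (π 1)) := by rw [← hgg]
      have hlob := hlo' (π g') b ⟨hb, hπb⟩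
      have hbhi := hhi' (π g') b ⟨hb, hπb⟩
      by_cases ht : 0 ≤ t g'
      · rw [if_pos ht] at heq
        have h1 : lev (g' * hi (π g')) - lev (g' * lo (π g')) =
          lev (hi (π g')) - lev (lo (π g')) := htrans _ _ _ ((hlo _).2.trans (hhi _).2.symm)
        have hlt : lev b < lev (hi (π g')) := by
          refine lt_of_le_of_ne hbhi fun hl ↦ hne ?_
          have := hinj b hb _ (hhi _).1 (hπb.trans (hhi _).2.symm) hl
          rw [this] at heq
          exact mul_right_cancel heq
        have hgap := hδ b hb _ (hhi _).1 hlt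
        rw [heq] at hblo
        have htg' : t g' = lev (g' * lo (π g')) - lev (1 * lo (π 1)) := rfl
        rw [abs_of_nonneg ht, abs_of_nonneg (by linarith)]
        linarith
      · rw [if_neg ht] at heq
        have hlt : lev (lo (π g')) < lev b := by
          refine lt_of_le_of_ne hlob fun hl ↦ hne ?_
          have := hinj b hb _ (hlo _).1 (hπb.trans (hlo _).2.symm) hl.symm
          rw [this] at heq
          exact mul_right_cancel heq
        have hgap := hδ _ (hlo _).1 b hb hlt
        rw [heq] at hblo
        have htg' : t g' = lev (g' * lo (π g')) - lev (1 * lo (π 1)) := rfl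
        rw [abs_of_neg (not_le.1 ht), abs_of_nonpos (by linarith)]
        linarith
    · exact Or.inl (hpeel _ _ _ (Finset.mem_image_of_mem π hb) hgg hπeq)

/-- The quotients of a group by the terms of `relSeries` are peelable. -/
lemma peelable_quotient_relSeries {G : Type*} [Group G] (N : Subgroup G) [N.Normal] (i : ℕ) :
    Peelable (G ⧸ relSeries N i) := by
  induction i with
  | zero =>
    have : Subsingleton (G ⧸ relSeries N 0) := QuotientGroup.subsingleton_quotient_top
    exact Peelable.of_subsingleton _
  | succ i ih =>
    have hle := relSeries_antitone N (Nat.le_succ i)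
    let π := QuotientGroup.map (relSeries N (i + 1)) (relSeries N i) (MonoidHom.id G) hle
    have hker : ∀ g : G, (g : G ⧸ relSeries N (i + 1)) ∈ π.ker ↔ g ∈ relSeries N i := fun g ↦
      QuotientGroup.eq_one_iff g
    refine ih.of_ker π ?_ ?_ ?_
    · rintro ⟨g⟩
      exact ⟨(g : G ⧸ _), rfl⟩
    · rintro ⟨a⟩ ha ⟨b⟩ hb
      have := commutator_le_relSeries_succ N i
        (Subgroup.commutator_mem_commutator ((hker a).1 ha) ((hker b).1 hb))
      rw [← QuotientGroup.eq_one_iff] at this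
      exact commutatorElement_eq_one_iff_mul_comm.1 this
    · rintro ⟨a⟩ ha k hk h
      exact (QuotientGroup.eq_one_iff a).2
        (mem_relSeries_succ_of_pow_mem N ((hker a).1 ha) hk ((QuotientGroup.eq_one_iff _).1 h))

/-- A combination of translates of a chain `f` which is supported inside the support of `f` is a
multiple of `f`. -/
theorem Peelable.eq_smul_of_support_subset {S Q : Type*} [Group Q] (hQ : Peelable Q)
    {f : (Q × S) →₀ ℤ} (hf : f ≠ 0) (α : Q →₀ ℤ)
    (h : ∀ x s, f (x, s) = 0 → α.sum (fun q n ↦ n * f (q⁻¹ * x, s)) = 0) :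
    ∀ q, q ≠ 1 → α q = 0 := by
  classical
  obtain ⟨⟨b₀, s⟩, hb₀⟩ := DFunLike.ne_iff.1 hf
  let B := (f.support.filter fun e ↦ e.2 = s).image Prod.fst
  have hB : ∀ b, b ∈ B ↔ f (b, s) ≠ 0 := by
    intro b
    simp [B]
  obtain ⟨β, R, hβ, hR, hR1, hpeel⟩ := hQ B ⟨b₀, (hB _).2 hb₀⟩
  by_contra! hα
  obtain ⟨q₀, hq₀, hαq₀⟩ := hα
  obtain ⟨q, hq, hmax⟩ := Finset.exists_max_image (α.support.erase 1)
    (IsWellFounded.rank (hwf := ⟨hR⟩) R) ⟨q₀, by simp [hq₀, hαq₀]⟩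
  rw [Finset.mem_erase, Finsupp.mem_support_iff] at hq
  have hout : f (q * β q, s) = 0 := by
    by_contra hne
    refine hR1 q (hpeel 1 q (q * β q) ((hB _).2 hne) hq.1.symm (one_mul _))
  refine absurd (h _ _ hout) ?_
  rw [Finsupp.sum, Finset.sum_eq_single q]
  · simpa using ⟨hq.2, (hB _).1 (hβ q)⟩
  · intro g hg hgq
    by_contra hne
    have hgf : f (g⁻¹ * (q * β q), s) ≠ 0 := right_ne_zero_of_mul hne
    have hRg := hpeel g q _ ((hB _).2 hgf) hgq (mul_inv_cancel_left _ _)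
    have hg1 : g ≠ 1 := fun h1 ↦ hR1 q (h1 ▸ hRg)
    have := IsWellFounded.rank_lt_of_rel (hwf := ⟨hR⟩) hRg
    exact absurd (hmax g (Finset.mem_erase.2 ⟨hg1, hg⟩)) (not_le.2 this)
  · intro hq'
    exact absurd (Finsupp.mem_support_iff.2 hq.2) hq'

end Peeling

section Elimination

/-- Triangular systems of equations along a well-founded relation have unique solutions with
prescribed values of the free variables. -/
lemma exists_solution_of_wellFounded {I E X : Type*} {R : I → I → Prop} (hR : WellFounded R)
    {m : I → E} (hm : Function.Injective m) (solve : I → (E → X) → X)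
    (hsolve : ∀ i f f', (∀ e ∉ Set.range m, f e = f' e) → (∀ j, R j i → f (m j) = f' (m j)) →
      solve i f = solve i f') (f₀ : E → X) :
    ∃ f : E → X, (∀ e ∉ Set.range m, f e = f₀ e) ∧ ∀ i, f (m i) = solve i f := by
  classical
  let val : I → X := hR.fix fun i rec ↦ solve i fun e ↦
    if h : ∃ j, e = m j ∧ R j i then rec h.choose h.choose_spec.2 else f₀ e
  let f : E → X := fun e ↦ if h : ∃ j, m j = e then val h.choose else f₀ e
  have hf : ∀ i, f (m i) = val i := by
    intro i
    have h : ∃ j, m j = m i := ⟨i, rfl⟩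
    simp only [f, dif_pos h]
    rw [hm h.choose_spec]
  have hf' : ∀ e ∉ Set.range m, f e = f₀ e := fun e he ↦ dif_neg he
  refine ⟨f, hf', fun i ↦ ?_⟩
  rw [hf]
  refine (hR.fix_eq _ i).trans (hsolve _ _ _ (fun e he ↦ ?_) fun j hj ↦ ?_)
  · rw [hf' e he, dif_neg]
    rintro ⟨j, rfl, -⟩
    exact he ⟨j, rfl⟩
  · have h : ∃ k, m j = m k ∧ R k i := ⟨j, rfl, hj⟩
    rw [hf, dif_pos h]
    exact congrArg val (hm h.choose_spec.1).symm

lemma solution_unique_of_wellFounded {I E X : Type*} {R : I → I → Prop} (hR : WellFounded R)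
    {m : I → E} (solve : I → (E → X) → X)
    (hsolve : ∀ i f f', (∀ e ∉ Set.range m, f e = f' e) → (∀ j, R j i → f (m j) = f' (m j)) →
      solve i f = solve i f') {f f' : E → X} (h : ∀ e ∉ Set.range m, f e = f' e)
    (hf : ∀ i, f (m i) = solve i f) (hf' : ∀ i, f' (m i) = solve i f') : f = f' := by
  have key : ∀ i, f (m i) = f' (m i) := fun i ↦ by
    induction i using hR.induction with
    | _ i ih => rw [hf, hf', hsolve i f f' h ih]
  funext e
  by_cases he : e ∈ Set.range m
  · obtain ⟨i, rfl⟩ := he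
    exact key i
  · exact h e he

universe u

variable {S Q : Type u} [Group Q] {π : FreeGroup S →* Q}

/-- For a relator spelling a simple closed path in a peelable Cayley graph, one can pick an edge
of every translate of the path such that the corresponding relations can be solved uniquely for
the labels of these edges. -/
lemma Peelable.exists_elimination (hQ : Peelable Q) {l : List (S × Bool)} (hl : l ≠ [])
    (hnd : ((pathEdges π 1 l).map Prod.fst).Nodup) :
    ∃ E : Set (Q × S), ∀ (X : Type u) [Group X],
      (∀ f₀ : Q × S → X, ∃ f : Q × S → X, (∀ e ∈ E, f e = f₀ e) ∧
        ∀ g, hol π f (FreeGroup.mk l) g = 1) ∧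
      ∀ f f' : Q × S → X, (∀ e ∈ E, f e = f' e) → (∀ g, hol π f (FreeGroup.mk l) g = 1) →
        (∀ g, hol π f' (FreeGroup.mk l) g = 1) → f = f' := by
  classical
  obtain ⟨a, ha⟩ : ∃ d, d ∈ (pathEdges π 1 l).map Prod.fst := by
    refine List.exists_mem_of_ne_nil _ fun h ↦ hl ?_
    have := congrArg List.length h
    rw [List.length_map, length_pathEdges] at this
    exact List.length_eq_zero_iff.1 this
  let s := a.2
  let B : Finset Q := (((pathEdges π 1 l).map Prod.fst).toFinset.filter fun e ↦ e.2 = s).image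
    Prod.fst
  have hB : ∀ b, b ∈ B ↔ (b, s) ∈ (pathEdges π 1 l).map Prod.fst := by
    intro b
    simp [B]
  obtain ⟨β, R, hβ, hR, hR1, hpeel⟩ := hQ B ⟨a.1, (hB _).2 ha⟩
  let m : Q → Q × S := fun g ↦ (g * β g, s)
  have hm : Function.Injective m := by
    intro g g' h
    by_contra hne
    have h : g * β g = g' * β g' := congrArg Prod.fst h
    exact hR.asymmetric _ _ (hpeel g g' _ (hβ g) hne h) (hpeel g' g _ (hβ g') (Ne.symm hne) h.symm)
  have hfst : ∀ g, (pathEdges π g l).map Prod.fst =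
      ((pathEdges π 1 l).map Prod.fst).map (Prod.map (g * ·) id) := by
    intro g
    have := pathEdges_translate π g 1 l
    rw [mul_one] at this
    rw [this, List.map_map, List.map_map]
    rfl
  have hmem : ∀ g, ∃ L₁ L₂ b, pathEdges π g l = L₁ ++ (m g, b) :: L₂ ∧
      m g ∉ L₁.map Prod.fst ∧ m g ∉ L₂.map Prod.fst := by
    intro g
    have h1 : m g ∈ (pathEdges π g l).map Prod.fst := by
      rw [hfst]
      exact List.mem_map.2 ⟨_, (hB _).1 (hβ g), rfl⟩
    obtain ⟨⟨e, b⟩, hd, he⟩ := List.mem_map.1 h1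
    obtain ⟨L₁, L₂, hL⟩ := List.append_of_mem hd
    have h2 : ((pathEdges π g l).map Prod.fst).Nodup := by
      rw [hfst]
      exact hnd.map ((mul_right_injective g).prodMap Function.injective_id)
    rw [hL, List.map_append, List.map_cons, List.nodup_middle, List.nodup_cons, List.mem_append,
      not_or] at h2
    simp only at he
    subst he
    exact ⟨L₁, L₂, b, hL, h2.1⟩
  choose L₁ L₂ b hL hL₁ hL₂ using hmem
  refine ⟨(Set.range m)ᶜ, fun X _ ↦ ?_⟩
  let solve : Q → (Q × S → X) → X := fun g f ↦
    if b g then ((L₁ g).map (signedLabel f)).prod⁻¹ * ((L₂ g).map (signedLabel f)).prod⁻¹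
    else (((L₁ g).map (signedLabel f)).prod⁻¹ * ((L₂ g).map (signedLabel f)).prod⁻¹)⁻¹
  have hiff : ∀ g f, hol π f (FreeGroup.mk l) g = 1 ↔ f (m g) = solve g f := by
    intro g f
    rw [hol_mk, hL, List.map_append, List.map_cons, List.prod_append, List.prod_cons]
    simp only [signedLabel, solve]
    split_ifs
    · rw [← mul_assoc, mul_eq_one_iff_eq_inv, ← eq_inv_mul_iff_mul_eq]
    · rw [← mul_assoc, mul_eq_one_iff_eq_inv, ← eq_inv_mul_iff_mul_eq, inv_eq_iff_eq_inv]
  have hlocal : ∀ g f f', (∀ e ∉ Set.range m, f e = f' e) →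
      (∀ j, R j g → f (m j) = f' (m j)) → ∀ d ∈ pathEdges π g l, d.1 ≠ m g →
      signedLabel f d = signedLabel (X := X) f' d := by
    intro g f f' h h' d hd hdg
    have : f d.1 = f' d.1 := by
      by_cases hr : d.1 ∈ Set.range m
      · obtain ⟨g', hg'⟩ := hr
        rw [← hg']
        have h1 : d.1 ∈ (pathEdges π g l).map Prod.fst := List.mem_map_of_mem hd
        rw [hfst] at h1
        obtain ⟨⟨x, t⟩, hx, hxd⟩ := List.mem_map.1 h1
        rw [← hg'] at hxd
        obtain ⟨hx1, rfl⟩ := Prod.mk.inj hxd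
        refine h' g' (hpeel g g' x ((hB x).2 hx) ?_ hx1)
        rintro rfl
        exact hdg hg'.symm
      · exact h _ hr
    simp only [signedLabel, this]
  have hsolve : ∀ g f f', (∀ e ∉ Set.range m, f e = f' e) →
      (∀ j, R j g → f (m j) = f' (m j)) → solve g f = solve g f' := by
    intro g f f' h h'
    have e₁ : (L₁ g).map (signedLabel f) = (L₁ g).map (signedLabel f') :=
      List.map_congr_left fun d hd ↦ hlocal g f f' h h' d (by simp [hL, hd]) fun hdg ↦
        hL₁ g (hdg ▸ List.mem_map_of_mem hd)
    have e₂ : (L₂ g).map (signedLabel f) = (L₂ g).map (signedLabel f') :=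
      List.map_congr_left fun d hd ↦ hlocal g f f' h h' d (by simp [hL, hd]) fun hdg ↦
        hL₂ g (hdg ▸ List.mem_map_of_mem hd)
    simp only [solve, e₁, e₂]
  simp only [hiff]
  exact ⟨exists_solution_of_wellFounded hR hm solve hsolve,
    fun f f' h ↦ solution_unique_of_wellFounded hR solve hsolve h⟩

/-- If the relator spells a simple closed path in a peelable Cayley graph, then the kernel of the
map from the one-relator group is free. -/
theorem Peelable.isFreeGroup_ker (hQ : Peelable Q) {l : List (S × Bool)} (hl : l ≠ [])
    (hnd : ((pathEdges π 1 l).map Prod.fst).Nodup) (hπ : Function.Surjective π)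
    (hc : π (FreeGroup.mk l) = 1)
    (p : FreeGroup S ⧸ Subgroup.normalClosure {FreeGroup.mk l} →* Q)
    (hp : ∀ u : FreeGroup S, p u = π u) : IsFreeGroup p.ker := by
  classical
  obtain ⟨E, hE⟩ := hQ.exists_elimination hl hnd
  obtain ⟨f, hfE, hf⟩ := (hE (FreeGroup E)).1 fun e ↦
    if h : e ∈ E then FreeGroup.of ⟨e, h⟩ else 1
  have hlift : ∀ u ∈ Subgroup.normalClosure {FreeGroup.mk l}, holHom π f u = 1 := by
    intro u hu
    ext q
    · exact hol_eq_one_of_mem_normalClosure π f hc hf hu q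
    · have : Subgroup.normalClosure {FreeGroup.mk l} ≤ π.ker :=
        Subgroup.normalClosure_le_normal (by simpa using hc)
      rw [holHom_right, this hu]; rfl
  let Φ := QuotientGroup.lift _ (holHom π f) hlift
  have hΦ : ∀ x, (Φ x).right = p x := by
    rintro ⟨u⟩
    exact (holHom_right π f u).trans (hp u).symm
  let Ψ : p.ker →* FreeGroup E :=
    { toFun := fun x ↦ (Φ x).left 1
      map_one' := by simp
      map_mul' := fun x y ↦ by
        rw [Subgroup.coe_mul, map_mul, SemidirectProduct.mul_left, hΦ, (x.2 : p x = 1), map_one]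
        rfl }
  obtain ⟨σ, hσ⟩ : ∃ σ, Function.RightInverse σ p :=
    Function.Surjective.hasRightInverse fun q ↦ (hπ q).imp' _ fun u hu ↦ (hp u).trans hu
  let f' : Q × S → p.ker := fun e ↦
    ⟨σ e.1 * QuotientGroup.mk' _ (FreeGroup.of e.2) * (σ (e.1 * π (FreeGroup.of e.2)))⁻¹, by
      simp [hσ _, hp]⟩
  have hf' : ∀ u q, p.ker.subtype (hol π f' u q) =
      σ q * QuotientGroup.mk' _ u * (σ (q * π u))⁻¹ := fun u q ↦ by
    rw [map_hol]
    exact hol_section π (QuotientGroup.mk' _) σ u q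
  have hff' : (fun e ↦ FreeGroup.lift (fun e : E ↦ f' e) (f e)) = f' := by
    refine (hE p.ker).2 _ _ (fun e he ↦ ?_) (fun g ↦ ?_) fun g ↦ Subtype.ext ?_
    · simp [hfE e he, he]
    · rw [← map_hol, hf, map_one]
    · have : QuotientGroup.mk' (Subgroup.normalClosure {FreeGroup.mk l}) (FreeGroup.mk l) = 1 :=
        (QuotientGroup.eq_one_iff _).2 (Subgroup.subset_normalClosure rfl)
      refine (hf' _ _).trans ?_
      rw [this, hc]
      simp
  have hinj : Function.Injective Ψ := by
    rw [injective_iff_map_eq_one]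
    rintro ⟨⟨u⟩, hu⟩ h
    have hπu : π u = 1 := (hp u).symm.trans hu
    have h1 : hol π f u 1 = 1 := h
    have h2 := map_hol π f (FreeGroup.lift fun e : E ↦ f' e) u 1
    rw [h1, map_one, hff'] at h2
    have h3 := hf' u 1
    rw [← h2, hπu] at h3
    rw [mul_one, map_one, eq_comm, conj_eq_one_iff] at h3
    exact Subtype.ext h3
  exact IsFreeGroup.ofMulEquiv (MonoidHom.ofInjective hinj).symm

end Elimination

section FreeGroupSeries

variable {S : Type*}

lemma subsingleton_of_isFreeGroup_of_commutator_eq_top {G : Type*} [Group G] [IsFreeGroup G]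
    (h : _root_.commutator G = ⊤) : Subsingleton G := by
  have : IsEmpty (IsFreeGroup.Generators G) := by
    refine ⟨fun x ↦ ?_⟩
    let φ : G →* Multiplicative ℤ := IsFreeGroup.lift fun _ ↦ Multiplicative.ofAdd 1
    have h1 : φ (IsFreeGroup.of x) = 1 :=
      Abelianization.commutator_subset_ker φ (h ▸ Subgroup.mem_top _)
    rw [IsFreeGroup.lift_of] at h1
    exact one_ne_zero (α := ℤ) h1
  exact (IsFreeGroup.toFreeGroup G).toEquiv.subsingleton

variable (N : Subgroup (FreeGroup S)) [N.Normal]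

/-- The map from the quotient by `relOmega N` to the quotient by a term of the series. -/
def relOmegaMap (i : ℕ) : FreeGroup S ⧸ relOmega N →* FreeGroup S ⧸ relSeries N i :=
  QuotientGroup.map _ _ (MonoidHom.id _) (relOmega_le N i)

lemma fox_relOmegaMap (i : ℕ) (u : FreeGroup S) (q : FreeGroup S ⧸ relOmega N) :
    fox (QuotientGroup.mk' (relSeries N i)) u (relOmegaMap N i q) =
      (fox (QuotientGroup.mk' (relOmega N)) u q).mapDomain (Prod.map (relOmegaMap N i) id) :=
  fox_comp (QuotientGroup.mk' (relOmega N)) (relOmegaMap N i) u q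

lemma pathEdges_relOmegaMap (i : ℕ) (l : List (S × Bool)) (q : FreeGroup S ⧸ relOmega N) :
    pathEdges (QuotientGroup.mk' (relSeries N i)) (relOmegaMap N i q) l =
      (pathEdges (QuotientGroup.mk' (relOmega N)) q l).map
        (Prod.map (Prod.map (relOmegaMap N i) id) id) :=
  pathEdges_comp (QuotientGroup.mk' (relOmega N)) (relOmegaMap N i) q l

/-- Finitely many edges are separated at a finite stage of the series. -/
lemma exists_injOn_relOmegaMap (T : Set ((FreeGroup S ⧸ relOmega N) × S)) (hT : T.Finite) :
    ∃ j, Set.InjOn (Prod.map (relOmegaMap N j) (id : S → S)) T := by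
  obtain ⟨j, hj⟩ := exists_injOn_relSeries (N := N) (Prod.fst '' T) (hT.image _)
  refine ⟨j, fun a ha b hb h ↦ ?_⟩
  obtain ⟨h1, h2⟩ := Prod.mk.inj h
  exact Prod.ext (hj j le_rfl ⟨a, ha, rfl⟩ ⟨b, hb, rfl⟩ h1) h2

variable {N}

lemma mem_commutator_of_fox_mk'_eq_zero {u : FreeGroup S} (hu : u ∈ N) {q : FreeGroup S ⧸ N}
    (h : fox (QuotientGroup.mk' N) u q = 0) : u ∈ ⁅N, N⁆ := by
  have := mem_commutator_of_fox_eq_zero (QuotientGroup.mk' N) (QuotientGroup.mk'_surjective N)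
    (by simpa using hu) h
  rwa [QuotientGroup.ker_mk'] at this

lemma relOmega_bot : relOmega (⊥ : Subgroup (FreeGroup S)) = ⊥ := by
  let K := relOmega (⊥ : Subgroup (FreeGroup S))
  have key : K ≤ ⁅K, K⁆ := by
    intro u hu
    have hfox : ∀ i q, fox (QuotientGroup.mk' (relSeries ⊥ i)) u q = 0 := by
      intro i q
      obtain ⟨hui, k, hk, huk⟩ := (mem_relSeries_succ ⊥).1 (relOmega_le ⊥ (i + 1) hu)
      rw [sup_bot_eq] at huk
      have h1 := fox_eq_zero_of_mem_commutator (QuotientGroup.mk' (relSeries ⊥ i)) (u := u ^ k)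
        (by rwa [QuotientGroup.ker_mk']) q
      rw [fox_pow _ (by simpa using hui)] at h1
      exact (smul_eq_zero.1 h1).resolve_left (by lia)
    obtain ⟨j, hj⟩ := exists_injOn_relOmegaMap (⊥ : Subgroup (FreeGroup S))
      ↑(fox (QuotientGroup.mk' K) u 1).support (Finset.finite_toSet _)
    refine mem_commutator_of_fox_mk'_eq_zero (q := 1) hu ?_
    refine Finsupp.mapDomain_injOn _ hj (by simp [K]) (by simp) ?_
    rw [← fox_relOmegaMap, hfox, Finsupp.mapDomain_zero]
  have hcomm : _root_.commutator K = ⊤ := by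
    rw [eq_top_iff]
    rintro ⟨u, hu⟩ -
    have := key hu
    rw [← Subgroup.map_subtype_commutator] at this
    obtain ⟨y, hy, rfl⟩ := this
    exact hy
  have := subsingleton_of_isFreeGroup_of_commutator_eq_top hcomm
  exact Subgroup.eq_bot_of_subsingleton K

/-- Free groups are residually rationally solvable. -/
theorem ratDerivedOmega_eq_bot_of_isFreeGroup (G : Type*) [Group G] [IsFreeGroup G] :
    ratDerivedOmega G = ⊥ := by
  let X := IsFreeGroup.Generators G
  have h : ratDerivedOmega (FreeGroup X ⧸ (⊥ : Subgroup (FreeGroup X))) = ⊥ := by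
    rw [eq_bot_iff]
    rintro ⟨g⟩ hg
    have : g ∈ relOmega (⊥ : Subgroup (FreeGroup X)) := by
      rw [← comap_ratDerivedOmega]; exact hg
    rw [relOmega_bot] at this
    exact (QuotientGroup.eq_one_iff g).2 this
  exact ratDerivedOmega_eq_bot_of_injective
    ((QuotientGroup.quotientBot.symm : FreeGroup X ≃* _).toMonoidHom.comp
      (IsFreeGroup.toFreeGroup G).toMonoidHom)
    ((QuotientGroup.quotientBot.symm : FreeGroup X ≃* _).injective.comp
      (IsFreeGroup.toFreeGroup G).injective) h

lemma fox_relOmega_ne_zero {w : FreeGroup S} (hw : w ≠ 1) :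
    fox (QuotientGroup.mk' (relOmega (Subgroup.normalClosure {w}))) w 1 ≠ 0 := by
  intro h
  have hwN : w ∈ Subgroup.normalClosure {w} := Subgroup.subset_normalClosure rfl
  have hcomm : ∀ i, w ∈ ⁅relSeries (Subgroup.normalClosure {w}) i,
      relSeries (Subgroup.normalClosure {w}) i⁆ := by
    intro i
    refine mem_commutator_of_fox_mk'_eq_zero (q := 1) (le_relSeries _ i hwN) ?_
    rw [← map_one (relOmegaMap _ i), fox_relOmegaMap, h, Finsupp.mapDomain_zero]
  have hle : ∀ i, relSeries (Subgroup.normalClosure {w}) i ≤ relSeries ⊥ i := by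
    intro i
    induction i with
    | zero => exact le_rfl
    | succ i ih =>
      refine relSeries_succ_le ih (Subgroup.normalClosure_le_normal (Set.singleton_subset_iff.2 ?_))
      exact commutator_le_relSeries_succ _ _ (Subgroup.commutator_mono ih ih (hcomm i))
  have : w ∈ relOmega (⊥ : Subgroup (FreeGroup S)) :=
    Subgroup.mem_iInf.2 fun i ↦ hle i (le_relSeries _ i hwN)
  rw [relOmega_bot] at this
  exact hw this

lemma exists_sum_of_mem_closure_range {I M : Type*} [AddCommGroup M] {v : I → M} {x : M}
    (hx : x ∈ AddSubgroup.closure (Set.range v)) :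
    ∃ α : I →₀ ℤ, α.sum (fun i n ↦ n • v i) = x := by
  rw [← Finsupp.mem_span_range_iff_exists_finsupp, ← Submodule.mem_toAddSubgroup,
    Submodule.span_int_eq_addSubgroupClosure]
  exact hx

/-- A simple closed path supported on the Fox chain of the relator has, up to multiples, the same
Fox chain as the relator. -/
lemma exists_smul_fox_eq {w : FreeGroup S}
    (hw : fox (QuotientGroup.mk' (relOmega (Subgroup.normalClosure {w}))) w 1 ≠ 0)
    {x : FreeGroup S ⧸ relOmega (Subgroup.normalClosure {w})} {l : List (S × Bool)} (hl : l ≠ [])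
    (hc : FreeGroup.mk l ∈ relOmega (Subgroup.normalClosure {w}))
    (hnd : ((pathEdges (QuotientGroup.mk' _) x l).map Prod.fst).Nodup)
    (hsupp : ∀ e ∈ (pathEdges (QuotientGroup.mk' _) x l).map Prod.fst,
      fox (QuotientGroup.mk' (relOmega (Subgroup.normalClosure {w}))) w 1 e ≠ 0) :
    ∃ (k : ℕ) (r : ℤ), 1 ≤ k ∧ r ≠ 0 ∧
      k • fox (QuotientGroup.mk' _) (FreeGroup.mk l) x =
        r • fox (QuotientGroup.mk' (relOmega (Subgroup.normalClosure {w}))) w 1 := by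
  classical
  set N := Subgroup.normalClosure {w}
  set f := fox (QuotientGroup.mk' (relOmega N)) w 1
  set g := fox (QuotientGroup.mk' (relOmega N)) (FreeGroup.mk l) x
  have hgf : ∀ e, g e ≠ 0 → f e ≠ 0 := fun e he ↦ by
    by_contra hfe
    exact he (fox_mk_eq_zero fun h ↦ hsupp e h hfe)
  have hgsub : g.support ⊆ f.support := fun e he ↦ by
    rw [Finsupp.mem_support_iff] at he ⊢
    exact hgf e he
  obtain ⟨j, hj⟩ := exists_injOn_relOmegaMap N ↑f.support (Finset.finite_toSet _)
  let π := QuotientGroup.mk' (relSeries N j)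
  have hw1 : π w = 1 := (QuotientGroup.eq_one_iff w).2
    (le_relSeries N j (Subgroup.subset_normalClosure rfl))
  have hc1 : π (FreeGroup.mk l) = 1 := (QuotientGroup.eq_one_iff _).2 (relOmega_le N j hc)
  obtain ⟨-, k, hk, hck⟩ := (mem_relSeries_succ N).1 (relOmega_le N (j + 1) hc)
  have hfj : fox π w 1 = f.mapDomain (Prod.map (relOmegaMap N j) id) := by
    rw [← fox_relOmegaMap, map_one]
  have hgj : fox π (FreeGroup.mk l) (relOmegaMap N j x) =
      g.mapDomain (Prod.map (relOmegaMap N j) id) := fox_relOmegaMap N j _ _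
  have hmem := fox_mem_closure π hw1 (u := FreeGroup.mk l ^ k)
    (by rwa [QuotientGroup.ker_mk']) (relOmegaMap N j x)
  rw [fox_pow π hc1] at hmem
  obtain ⟨α, hα⟩ := exists_sum_of_mem_closure_range hmem
  have hfj0 : fox π w 1 ≠ 0 := by
    rw [hfj]
    intro h
    exact hw (Finsupp.mapDomain_injOn _ hj (Set.Subset.refl _) (by simp)
      (h.trans Finsupp.mapDomain_zero.symm))
  have hα1 : ∀ q, q ≠ 1 → α q = 0 := by
    refine (peelable_quotient_relSeries N j).eq_smul_of_support_subset hfj0 α fun y s hy ↦ ?_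
    have h1 : α.sum (fun q n ↦ n * fox π w 1 (q⁻¹ * y, s)) =
        (α.sum fun q n ↦ n • fox π w q) (y, s) := by
      rw [Finsupp.sum, Finsupp.sum, Finsupp.finsetSum_apply]
      refine Finset.sum_congr rfl fun q _ ↦ ?_
      have := fox_translate_apply π q 1 w (q⁻¹ * y) s
      rw [mul_one, mul_inv_cancel_left] at this
      rw [Finsupp.smul_apply, this, smul_eq_mul]
    rw [h1, hα, Finsupp.smul_apply]
    by_contra hne
    have hne' : fox π (FreeGroup.mk l) (relOmegaMap N j x) (y, s) ≠ 0 := right_ne_zero_of_smul hne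
    rw [hgj] at hne'
    obtain ⟨e, he, hey⟩ := Finset.mem_image.1
      (Finsupp.mapDomain_support (Finsupp.mem_support_iff.2 hne'))
    rw [hfj, ← hey, Finsupp.mapDomain_apply' _ _ subset_rfl hj (hgsub he)] at hy
    exact hgf e (Finsupp.mem_support_iff.1 he) hy
  have hαj : k • fox π (FreeGroup.mk l) (relOmegaMap N j x) = α 1 • fox π w 1 := by
    rw [← hα, Finsupp.sum]
    refine Finset.sum_eq_single 1 (fun q _ hq ↦ ?_) fun h1 ↦ ?_
    · rw [hα1 q hq, zero_smul]
    · rw [Finsupp.notMem_support_iff.1 h1, zero_smul]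
  have hlift : k • g = α 1 • f := by
    refine Finsupp.mapDomain_injOn _ hj ?_ ?_ ?_
    · exact Finset.coe_subset.2 (Finsupp.support_smul.trans hgsub)
    · exact Finset.coe_subset.2 Finsupp.support_smul
    · rw [Finsupp.mapDomain_smul, Finsupp.mapDomain_smul, ← hfj, ← hgj, hαj]
  refine ⟨k, α 1, hk, fun h0 ↦ ?_, hlift⟩
  rw [h0, zero_smul] at hlift
  exact fox_mk_ne_zero hl hnd ((smul_eq_zero.1 hlift).resolve_left (by lia))

/-- If the Fox chains of `c` and `w` are commensurable, then the normal closures of `c` and `w`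
have the same series. -/
lemma relSeries_eq_of_smul_fox_eq {w c : FreeGroup S}
    (hc : c ∈ relOmega (Subgroup.normalClosure {w}))
    {x : FreeGroup S ⧸ relOmega (Subgroup.normalClosure {w})} {k : ℕ} {r : ℤ} (hr : r ≠ 0)
    (h : k • fox (QuotientGroup.mk' _) c x =
        r • fox (QuotientGroup.mk' (relOmega (Subgroup.normalClosure {w}))) w 1) (i : ℕ) :
    relSeries (Subgroup.normalClosure {w}) i = relSeries (Subgroup.normalClosure {c}) i := by
  set N := Subgroup.normalClosure {w}
  set M := Subgroup.normalClosure {c}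
  obtain ⟨p, rfl⟩ := QuotientGroup.mk'_surjective _ x
  have hwN : w ∈ N := Subgroup.subset_normalClosure rfl
  have hcM : c ∈ M := Subgroup.subset_normalClosure rfl
  have hcomm : ∀ i, p * c ^ k * p⁻¹ * (w ^ r)⁻¹ ∈ ⁅relSeries N i, relSeries N i⁆ := by
    intro i
    have hwi := le_relSeries N i hwN
    have hci := relOmega_le N i hc
    have hw1 : QuotientGroup.mk' (relSeries N i) w = 1 := (QuotientGroup.eq_one_iff w).2 hwi
    have hc1 : QuotientGroup.mk' (relSeries N i) c = 1 := (QuotientGroup.eq_one_iff c).2 hci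
    refine mem_commutator_of_fox_mk'_eq_zero (q := 1) (mul_mem ((relSeries_normal N i).conj_mem _
      (pow_mem hci k) p) (inv_mem (zpow_mem hwi r))) ?_
    have hi : k • fox (QuotientGroup.mk' (relSeries N i)) c (QuotientGroup.mk' _ p) =
        r • fox (QuotientGroup.mk' (relSeries N i)) w 1 := by
      have h1 := congrArg (Finsupp.mapDomain (Prod.map (relOmegaMap N i) id)) h
      rw [Finsupp.mapDomain_smul, Finsupp.mapDomain_smul, ← fox_relOmegaMap, ← fox_relOmegaMap,
        map_one] at h1
      exact h1
    simp only [fox_mul, fox_inv, map_mul, map_pow, map_inv, map_zpow, hw1, hc1, one_pow, one_zpow,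
      mul_one, one_mul, inv_one, mul_inv_cancel, fox_pow _ hc1, fox_zpow _ hw1, hi]
    abel
  induction i with
  | zero => rw [relSeries_zero, relSeries_zero]
  | succ i ih =>
    refine le_antisymm (relSeries_succ_le ih.le (Subgroup.normalClosure_le_normal
      (Set.singleton_subset_iff.2 ?_))) (relSeries_succ_le ih.ge (Subgroup.normalClosure_le_normal
      (Set.singleton_subset_iff.2 (relOmega_le N (i + 1) hc))))
    have h1 : p * c ^ k * p⁻¹ * (w ^ r)⁻¹ ∈ relSeries M (i + 1) :=
      commutator_le_relSeries_succ M i (ih ▸ hcomm i)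
    have h2 : p * c ^ k * p⁻¹ ∈ relSeries M (i + 1) :=
      (relSeries_normal M (i + 1)).conj_mem _ (pow_mem (le_relSeries M (i + 1) hcM) k) p
    have h3 : w ^ r ∈ relSeries M (i + 1) := by
      rw [Subgroup.mul_mem_cancel_left _ h2] at h1
      exact (Subgroup.inv_mem_iff _).1 h1
    have h4 : w ^ r.natAbs ∈ relSeries M (i + 1) := by
      rcases Int.natAbs_eq r with h | h
      · rwa [h, zpow_natCast] at h3
      · rw [h, zpow_neg, zpow_natCast] at h3
        exact (Subgroup.inv_mem_iff _).1 h3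
    exact mem_relSeries_succ_of_pow_mem M (ih ▸ le_relSeries N i hwN)
      (Int.natAbs_pos.2 hr) h4

/-- Some term of the rational derived series of the one-relator group of a simple closed path is
free. -/
lemma exists_isFreeGroup_ratDerived {N : Subgroup (FreeGroup S)} [N.Normal] {l : List (S × Bool)}
    (hl : l ≠ []) (hc : FreeGroup.mk l ∈ relOmega N) {x : FreeGroup S ⧸ relOmega N}
    (hnd : ((pathEdges (QuotientGroup.mk' _) x l).map Prod.fst).Nodup)
    (hM : ∀ i, relSeries N i = relSeries (Subgroup.normalClosure {FreeGroup.mk l}) i) :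
    ∃ n, IsFreeGroup (ratDerived (FreeGroup S ⧸ Subgroup.normalClosure {FreeGroup.mk l}) n) := by
  obtain ⟨j, hj⟩ := exists_injOn_relOmegaMap N
    {e | e ∈ (pathEdges (QuotientGroup.mk' _) x l).map Prod.fst} (List.finite_toSet _)
  let π := QuotientGroup.mk' (relSeries N j)
  have hndj : ((pathEdges π 1 l).map Prod.fst).Nodup := by
    have h1 : ((pathEdges π (relOmegaMap N j x) l).map Prod.fst).Nodup := by
      rw [pathEdges_relOmegaMap, List.map_map]
      have := List.Nodup.map_on (fun a ha b hb ↦ hj ha hb) hnd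
      rwa [List.map_map] at this
    have h2 := pathEdges_translate π (relOmegaMap N j x)⁻¹ (relOmegaMap N j x) l
    rw [inv_mul_cancel] at h2
    have := h1.map ((mul_right_injective (relOmegaMap N j x)⁻¹).prodMap
      (Function.injective_id (α := S)))
    rw [List.map_map] at this
    rw [h2, List.map_map]
    exact this
  let p := QuotientGroup.map (Subgroup.normalClosure {FreeGroup.mk l}) (relSeries N j)
    (MonoidHom.id _) (hM j ▸ le_relSeries _ j)
  have hker : p.ker = ratDerived _ j := by
    ext ⟨u⟩
    exact (QuotientGroup.eq_one_iff u).trans (SetLike.ext_iff.1 (hM j) u)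
  refine ⟨j, hker ▸ ?_⟩
  exact (peelable_quotient_relSeries N j).isFreeGroup_ker hl hndj (QuotientGroup.mk'_surjective _)
    ((QuotientGroup.eq_one_iff _).2 (relOmega_le N j hc)) p fun _ ↦ rfl

end FreeGroupSeries

/-- For a one-relator group `G = F/⟪w⟫`, there is `n ≥ 0` such that
`D^n(G)/D^ω(G)` is a free group: `D^n(G)` is free-by-(maximal rationally perfect subgroup). -/
theorem ratDerived_quotient_omega_free {S : Type*} (w : FreeGroup S) :
    ∃ n : ℕ,
      IsFreeGroup
        (↥(ratDerived (FreeGroup S ⧸ Subgroup.normalClosure {w}) n) ⧸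
          (ratDerivedOmega (FreeGroup S ⧸ Subgroup.normalClosure {w})).subgroupOf
            (ratDerived (FreeGroup S ⧸ Subgroup.normalClosure {w}) n)) := by
  by_cases hw : w = 1
  · have hbot : Subgroup.normalClosure {w} = ⊥ := by
      rw [hw, Subgroup.normalClosure_eq_bot_iff]
    have : IsFreeGroup (FreeGroup S ⧸ Subgroup.normalClosure {w}) := IsFreeGroup.ofMulEquiv
      (QuotientGroup.quotientBot.symm.trans (QuotientGroup.quotientMulEquivOfEq hbot.symm))
    exact ⟨0, isFreeGroup_quotient_of_relSeries_eq (fun _ ↦ rfl)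
      (ratDerivedOmega_eq_bot_of_isFreeGroup _) inferInstance⟩
  · have hf := fox_relOmega_ne_zero hw
    have hw1 : QuotientGroup.mk' (relOmega (Subgroup.normalClosure {w})) w = 1 :=
      (QuotientGroup.eq_one_iff w).2 (le_relOmega _ (Subgroup.subset_normalClosure rfl))
    obtain ⟨x, l, hl, hc, hnd, hsupp⟩ := exists_simple_closed_path
      (by rw [edgeBoundary_fox, hw1, mul_one, sub_self]) hf
    replace hc := (QuotientGroup.eq_one_iff _).1 hc
    obtain ⟨k, r, -, hr, h⟩ := exists_smul_fox_eq hf hl hc hnd hsupp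
    have hM := relSeries_eq_of_smul_fox_eq hc hr h
    obtain ⟨n, hn⟩ := exists_isFreeGroup_ratDerived hl hc hnd hM
    exact ⟨n, isFreeGroup_quotient_of_relSeries_eq hM
      (ratDerivedOmega_eq_bot_of_ratDerived (ratDerivedOmega_eq_bot_of_isFreeGroup
        (ratDerived (FreeGroup S ⧸ Subgroup.normalClosure {FreeGroup.mk l}) n))) hn⟩
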